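/- arXiv:1603.07139 — 11 statements merged into one kernel-verified Lean document; each statement's English description precedes it below -/
import Mathlib

section
/- Let m be an integer with 0 ≤ m ≤ 4 and let x, y be rational numbers satisfying 5x + 3y = m, 5x² − 3y² + 6xy = −m, and such that 3x − 3y is an integer. Then (m, x, y) = (0, 0, 0), (1, 1/2, −1/2), or (3, 0, 1). -/
/-- Arithmetic classification in the proof of Proposition 3.1(2). -/
theorem stmt_3 (m : ℤ) (hm0 : 0 ≤ m) (hm4 : m ≤ 4) (x y : ℚ)
    (h1 : 5 * x + 3 * y = (m : ℚ))
    (h2 : 5 * x ^ 2 - 3 * y ^ 2 + 6 * x * y = -(m : ℚ))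
    (h3 : ∃ k : ℤ, 3 * x - 3 * y = (k : ℚ)) :
    ((m : ℚ), x, y) = (0, 0, 0) ∨ ((m : ℚ), x, y) = (1, 1/2, -1/2) ∨
      ((m : ℚ), x, y) = (3, 0, 1) := by
  obtain ⟨k, hk⟩ := h3
  obtain ⟨n, hn⟩ : ∃ n : ℤ, n = k + m := ⟨_, rfl⟩
  have hx : x = n / 8 := by
    rw [hn]; push_cast; linarith
  have hy : y = (m - 5 * x) / 3 := by linarith
  have hquad : 5 * n ^ 2 - 16 * m * n + 8 * m ^ 2 - 24 * m = 0 := by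
    rw [hy, hx] at h2
    have : (5 * n ^ 2 - 16 * m * n + 8 * m ^ 2 - 24 * m : ℚ) = 0 := by
      linear_combination (-24) * h2
    exact_mod_cast this
  have hlo : -1 ≤ n := by
    by_contra! h
    interval_cases m <;> nlinarith
  have hhi : n ≤ 13 := by
    by_contra! h
    interval_cases m <;> nlinarith
  clear hn
  subst hy hx
  interval_cases m <;> interval_cases n <;> first | omega | norm_num
end

section
/- Let m be an integer with 0 ≤ m ≤ 5 and let x, y be rational numbers satisfying 4x + 5y = m, 4x² − 5y² + 10xy = −m, and such that 5x − 5y is an integer. Then (m, x, y) = (0, 0, 0), (1, 2/3, −1/3), or (5, 0, 1). -/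
/-- Arithmetic classification in the proof of Proposition 3.17(2). -/
theorem stmt_8 (m : ℤ) (hm0 : 0 ≤ m) (hm5 : m ≤ 5) (x y : ℚ)
    (h1 : 4 * x + 5 * y = (m : ℚ))
    (h2 : 4 * x ^ 2 - 5 * y ^ 2 + 10 * x * y = -(m : ℚ))
    (h3 : ∃ k : ℤ, 5 * x - 5 * y = (k : ℚ)) :
    ((m : ℚ), x, y) = (0, 0, 0) ∨ ((m : ℚ), x, y) = (1, 2/3, -1/3) ∨
      ((m : ℚ), x, y) = (5, 0, 1) := by
  obtain ⟨k, hk⟩ := h3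
  obtain ⟨n, hn⟩ : ∃ n : ℤ, n = m + k := ⟨_, rfl⟩
  have hx : x = (n : ℚ) / 9 := by
    rw [hn]
    push_cast
    linarith
  have hy : y = ((m : ℚ) - 4 * x) / 5 := by linarith
  have hquad : 4 * n ^ 2 - 18 * m * n + 9 * m ^ 2 - 45 * m = 0 := by
    have : (4 * n ^ 2 - 18 * m * n + 9 * m ^ 2 - 45 * m : ℚ) = 0 := by
      rw [hy, hx] at h2
      linear_combination (-45) * h2
    exact_mod_cast this
  have hsol : (m = 0 ∧ n = 0) ∨ (m = 1 ∧ n = 6) ∨ (m = 5 ∧ n = 0) := by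
    clear hn hx
    have hlo : -12 ≤ n := by interval_cases m <;> nlinarith
    have hhi : n ≤ 23 := by interval_cases m <;> nlinarith
    interval_cases m <;> interval_cases n <;> simp_all
  rcases hsol with ⟨rfl, rfl⟩ | ⟨rfl, rfl⟩ | ⟨rfl, rfl⟩ <;>
    norm_num [hy, hx]
end

section
/- Equip ℤ² with the symmetric bilinear form ⟨·,·⟩ whose Gram matrix with respect to the standard basis (H, C) is ((18, 6), (6, 0)), i.e. ⟨H,H⟩ = 18, ⟨H,C⟩ = 6, ⟨C,C⟩ = 0. Let L = xH + yC with x, y ∈ ℤ and set N = H − L. If L ≠ 0, N ≠ 0, ⟨H,L⟩ > 0, ⟨H,N⟩ > 0, ⟨C,L⟩ ≥ 0, ⟨C,N⟩ ≥ 0, ⟨L,L⟩ ≥ 0 and ⟨N,N⟩ ≥ 0, then (x, y) = (0, 1) or (1, −1), and in both cases (⟨L,L⟩/2 + 2)·(⟨N,N⟩/2 + 2) = 10 < 11 = ⟨H,H⟩/2 + 2. -/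
/-- The symmetric bilinear form on ℤ² with Gram matrix ((18, 6), (6, 0)) with respect to
the standard basis. -/
def formBi2 (u v : ℤ × ℤ) : ℤ :=
  18 * u.1 * v.1 + 6 * u.1 * v.2 + 6 * u.2 * v.1 + 0 * u.2 * v.2

/-- Lattice-arithmetic core of Lemma 3.1 (Case (B-i-2)): Brill-Noether generality of the
polarized K3 surface with Picard lattice of Gram matrix ((18,6),(6,0)). -/
theorem stmt_10 (x y : ℤ) :
    let H : ℤ × ℤ := (1, 0)
    let C : ℤ × ℤ := (0, 1)
    let L : ℤ × ℤ := (x, y)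
    let N : ℤ × ℤ := H - L
    L ≠ 0 → N ≠ 0 →
    0 < formBi2 H L → 0 < formBi2 H N →
    0 ≤ formBi2 C L → 0 ≤ formBi2 C N →
    0 ≤ formBi2 L L → 0 ≤ formBi2 N N →
    ((x, y) = (0, 1) ∨ (x, y) = (1, -1)) ∧
    (formBi2 L L / 2 + 2) * (formBi2 N N / 2 + 2) = 10 ∧
    (10 : ℤ) < 11 ∧ formBi2 H H / 2 + 2 = 11 := by
  intro H C L N _ _ hHL hHN hCL hCN hLL hNN
  simp only [formBi2, H, C, L, N, Prod.mk_sub_mk] at hHL hHN hCL hCN hLL hNN ⊢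
  have hx : x = 0 ∨ x = 1 := by omega
  rcases hx with rfl | rfl
  · obtain rfl : y = 1 := by omega
    norm_num
  · obtain rfl : y = -1 := by omega
    norm_num
end

section
/- Equip ℤ² with the symmetric bilinear form ⟨·,·⟩ whose Gram matrix with respect to the standard basis (H, C) is ((16, 6), (6, 0)), i.e. ⟨H,H⟩ = 16, ⟨H,C⟩ = 6, ⟨C,C⟩ = 0. Let L = xH + yC with x, y ∈ ℤ and set N = H − L. If L ≠ 0, N ≠ 0, ⟨H,L⟩ > 0, ⟨H,N⟩ > 0, ⟨C,L⟩ ≥ 0, ⟨C,N⟩ ≥ 0, ⟨L,L⟩ ≥ 0 and ⟨N,N⟩ ≥ 0, then (x, y) = (0, 1) or (1, −1), and in both cases (⟨L,L⟩/2 + 2)·(⟨N,N⟩/2 + 2) = 8 < 10 = ⟨H,H⟩/2 + 2. -/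
/-- The symmetric bilinear form on ℤ² with Gram matrix ((16, 6), (6, 0)) with respect to
the standard basis. -/
def formBi3 (u v : ℤ × ℤ) : ℤ :=
  16 * u.1 * v.1 + 6 * u.1 * v.2 + 6 * u.2 * v.1 + 0 * u.2 * v.2

/-- Lattice-arithmetic core of Lemma 3.2 (Case (B-i-3)): Brill-Noether generality of the
polarized K3 surface with Picard lattice of Gram matrix ((16,6),(6,0)). -/
theorem stmt_11 (x y : ℤ) :
    let H : ℤ × ℤ := (1, 0)
    let C : ℤ × ℤ := (0, 1)
    let L : ℤ × ℤ := (x, y)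
    let N : ℤ × ℤ := H - L
    L ≠ 0 → N ≠ 0 →
    0 < formBi3 H L → 0 < formBi3 H N →
    0 ≤ formBi3 C L → 0 ≤ formBi3 C N →
    0 ≤ formBi3 L L → 0 ≤ formBi3 N N →
    ((x, y) = (0, 1) ∨ (x, y) = (1, -1)) ∧
    (formBi3 L L / 2 + 2) * (formBi3 N N / 2 + 2) = 8 ∧
    (8 : ℤ) < 10 ∧ formBi3 H H / 2 + 2 = 10 := by
  intro H C L N _ _ hHL hHN hCL hCN hLL hNN
  simp only [H, C, L, N, formBi3, Prod.fst_sub, Prod.snd_sub] at hHL hHN hCL hCN hLL hNN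
  have hx : x = 0 ∨ x = 1 := by omega
  have hxy : (x = 0 ∧ y = 1) ∨ (x = 1 ∧ y = -1) := by
    rcases hx with rfl | rfl
    · left; omega
    · right; omega
  rcases hxy with ⟨rfl, rfl⟩ | ⟨rfl, rfl⟩ <;> simp [H, L, N, formBi3]
end

section
/- Define q(x, y, z) = 6x² + 2z² + 8xy + 12xz + 6yz and ℓ(x, y, z) = 6x + 4y + 6z. There exist no integers x, y, z such that q(x, y, z) = 0 and ℓ(x, y, z) ∈ {1, 2, 3}. -/
def qBii (x y z : ℤ) : ℤ := 6 * x ^ 2 + 2 * z ^ 2 + 8 * x * y + 12 * x * z + 6 * y * z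

def lBii (x y z : ℤ) : ℤ := 6 * x + 4 * y + 6 * z

/-- Claims (i)-(iii) in Section 3.5 (Case (B-ii)). -/
theorem stmt_12 :
    ¬ ∃ x y z : ℤ, qBii x y z = 0 ∧ lBii x y z ∈ ({1, 2, 3} : Set ℤ) := by
  rintro ⟨x, y, z, hq, hl⟩
  simp only [qBii, lBii, Set.mem_insert_iff, Set.mem_singleton_iff] at hq hl
  have hy : 2 * y = 1 - 3 * x - 3 * z := by omega
  have hsq : (12 * x + 9 * z - 4) ^ 2 = 16 - 87 * z ^ 2 := by
    linear_combination -24 * hq + (96 * x + 72 * z) * hy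
  have hz : z = 0 := by
    have hz_sq : z ^ 2 < 1 := by linarith [sq_nonneg (12 * x + 9 * z - 4)]
    exact (sq_lt_one_iff_abs_lt_one z).mp hz_sq |> Int.abs_lt_one_iff.mp
  subst hz
  have hx : x * (3 * x - 2) = 0 := by linarith
  rcases mul_eq_zero.mp hx with h | h <;> omega
end

section
/- Define q(x, y, z) = 6x² + 2z² + 8xy + 12xz + 6yz and ℓ(x, y, z) = 6x + 4y + 6z. The only integers x, y, z satisfying q(x, y, z) = −2 and 0 < ℓ(x, y, z) ≤ 9 are (x, y, z) = (1, −1, 0) and (x, y, z) = (1, 1, −1). -/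
/-- The Hodge-index identity: `ℓ² - 6 q` is a positive definite form in `y` and `z`. -/
lemma lBii_sq_sub_six_mul_qBii (x y z : ℤ) :
    lBii x y z ^ 2 - 6 * qBii x y z = 16 * y ^ 2 + 12 * y * z + 24 * z ^ 2 := by
  unfold lBii qBii
  ring

/-- Claim (iv) in Section 3.5 (Case (B-ii)): the only (−2)-classes of degree at most 9
are C₂ = H − F and C₄ = H + F − B. -/
theorem stmt_13 (x y z : ℤ) :
    (qBii x y z = -2 ∧ 0 < lBii x y z ∧ lBii x y z ≤ 9) ↔
      ((x, y, z) = (1, -1, 0) ∨ (x, y, z) = (1, 1, -1)) := by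
  constructor
  · rintro ⟨hq, hpos, hle⟩
    have hform := lBii_sq_sub_six_mul_qBii x y z
    have hsq : lBii x y z ^ 2 ≤ 81 := by nlinarith
    have hy_le : y ≤ 2 := by nlinarith [sq_nonneg (y + 4 * z)]
    have hy_ge : -2 ≤ y := by nlinarith [sq_nonneg (y + 4 * z)]
    have hz_le : z ≤ 2 := by nlinarith [sq_nonneg (8 * y + 3 * z)]
    have hz_ge : -2 ≤ z := by nlinarith [sq_nonneg (8 * y + 3 * z)]
    clear hform hsq
    unfold lBii at hpos hle
    unfold qBii at hq
    have hx_le : x ≤ 5 := by omega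
    have hx_ge : -3 ≤ x := by omega
    interval_cases y <;> interval_cases z <;> interval_cases x <;> simp_all
  · rintro (h | h) <;> obtain ⟨rfl, rfl, rfl⟩ := by simpa using h
    all_goals decide
end

section
/- Define q(x, y, z) = 6x² − 2y² + 6z² + 4xy + 18xz + 12yz and ℓ(x, y, z) = 6x + 2y + 9z. There exist no integers x, y, z such that q(x, y, z) = 0 and ℓ(x, y, z) ∈ {1, 2, 3}. -/
def qBiii2 (x y z : ℤ) : ℤ :=
  6 * x ^ 2 - 2 * y ^ 2 + 6 * z ^ 2 + 4 * x * y + 18 * x * z + 12 * y * z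

def lBiii2 (x y z : ℤ) : ℤ := 6 * x + 2 * y + 9 * z

/-- Six times `q` is the square of `ℓ` minus a positive definite binary form, namely the projection
to the orthogonal complement of `H`. -/
theorem lBiii2_sq_sub_six_mul_qBiii2 (x y z : ℤ) :
    lBiii2 x y z ^ 2 - 6 * qBiii2 x y z = 16 * y ^ 2 - 36 * y * z + 45 * z ^ 2 := by
  unfold lBiii2 qBiii2
  ring

theorem binary_form_notMem_Icc (y z : ℤ) :
    16 * y ^ 2 - 36 * y * z + 45 * z ^ 2 ∉ Set.Icc (1 : ℤ) 9 := by
  rintro ⟨hpos, hle⟩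
  have hz : z ^ 2 < 1 := by nlinarith [sq_nonneg (8 * y - 9 * z)]
  obtain rfl : z = 0 := by
    rw [← sq_eq_zero_iff]
    exact le_antisymm (Int.lt_add_one_iff.mp hz) (sq_nonneg z)
  ring_nf at hpos hle
  omega

/-- Claims (i)-(iii) in Section 3.7 (Case (B-iii-2)). -/
theorem stmt_14 :
    ¬ ∃ x y z : ℤ, qBiii2 x y z = 0 ∧ lBiii2 x y z ∈ ({1, 2, 3} : Set ℤ) := by
  rintro ⟨x, y, z, hq, hl⟩
  have h := lBiii2_sq_sub_six_mul_qBiii2 x y z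
  apply binary_form_notMem_Icc y z
  rw [← h, hq]
  rcases hl with hl | hl | hl <;> rw [hl] <;> norm_num
end

section
/- Define q(x, y, z) = 6x² − 2y² + 6z² + 4xy + 18xz + 12yz and ℓ(x, y, z) = 6x + 2y + 9z. The only integers x, y, z satisfying q(x, y, z) = −2 and 0 < ℓ(x, y, z) ≤ 10 are (x, y, z) = (0, 1, 0) and (x, y, z) = (3, −2, −1). -/
/-- Completing the square in `x`: the orthogonal complement of the polarization is
negative definite. -/
theorem sixteen_mul_sq_sub_eq (x y z : ℤ) :
    16 * y ^ 2 - 36 * y * z + 45 * z ^ 2 =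
      (6 * x + 2 * y + 9 * z) ^ 2 -
        6 * (6 * x ^ 2 - 2 * y ^ 2 + 6 * z ^ 2 + 4 * x * y + 18 * x * z + 12 * y * z) := by
  ring

/-- Claim (iv) in Section 3.7 (Case (B-iii-2)): the only (−2)-classes of degree at most 10
are C₂ = Γ and C₅ = 3H − 2Γ − B. -/
theorem stmt_15 (x y z : ℤ) :
    (qBiii2 x y z = -2 ∧ 0 < lBiii2 x y z ∧ lBiii2 x y z ≤ 10) ↔
      ((x, y, z) = (0, 1, 0) ∨ (x, y, z) = (3, -2, -1)) := by
  simp only [Prod.mk.injEq, qBiii2, lBiii2]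
  constructor
  · rintro ⟨hq, hpos, hle⟩
    have hform : 16 * y ^ 2 - 36 * y * z + 45 * z ^ 2 ≤ 112 := by
      rw [sixteen_mul_sq_sub_eq x y z, hq]
      nlinarith
    have hy : |y| < 4 := abs_lt_of_sq_lt_sq (by nlinarith [sq_nonneg (5 * z - 2 * y)]) (by norm_num)
    have hz : |z| ≤ 2 := abs_le_of_sq_le_sq (by nlinarith [sq_nonneg (8 * y - 9 * z)]) (by norm_num)
    obtain ⟨hy₁, hy₂⟩ := abs_lt.mp hy
    obtain ⟨hz₁, hz₂⟩ := abs_le.mp hz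
    have hx₁ : -4 ≤ x := by omega
    have hx₂ : x ≤ 5 := by omega
    interval_cases y <;> interval_cases z <;> first | omega | (interval_cases x <;> omega)
  · rintro (⟨rfl, rfl, rfl⟩ | ⟨rfl, rfl, rfl⟩) <;> norm_num
end

section
/- Define q(x, y, z, w) = −2w² + 4xy + 4xz + 4yz + 6yw + 6zw and ℓ(x, y, z, w) = 2x + 2y + 4z + 3w. Then: (a) there exist no integers x, y, z, w with q(x, y, z, w) = 0 and ℓ(x, y, z, w) = 1; and (b) the only integers x, y, z, w satisfying q(x, y, z, w) = −2 and 0 < ℓ(x, y, z, w) ≤ 4 are (x, y, z, w) = (2, 0, 0, −1), (−1, 0, 0, 1), (0, 0, 0, 1), and (3, 0, 0, −1). -/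
def qBiii3 (x y z w : ℤ) : ℤ :=
  -2 * w ^ 2 + 4 * x * y + 4 * x * z + 4 * y * z + 6 * y * w + 6 * z * w

def lBiii3 (x y z w : ℤ) : ℤ := 2 * x + 2 * y + 4 * z + 3 * w

/-- The Hodge index inequality for `qBiii3` and `lBiii3`, with the defect as a sum of squares. -/
theorem lBiii3_sq_sub_four_mul_qBiii3 (x y z w : ℤ) :
    lBiii3 x y z w ^ 2 - 4 * qBiii3 x y z w =
      16 * z ^ 2 + (2 * (x - y) + 3 * w) ^ 2 + 8 * w ^ 2 := by
  unfold lBiii3 qBiii3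
  ring

/-- Claims (i) and (ii) in Section 3.8 (Case (B-iii-3)). -/
theorem stmt_16 :
    (¬ ∃ x y z w : ℤ, qBiii3 x y z w = 0 ∧ lBiii3 x y z w = 1) ∧
    (∀ x y z w : ℤ,
      (qBiii3 x y z w = -2 ∧ 0 < lBiii3 x y z w ∧ lBiii3 x y z w ≤ 4) ↔
        ((x, y, z, w) = (2, 0, 0, -1) ∨ (x, y, z, w) = (-1, 0, 0, 1) ∨
          (x, y, z, w) = (0, 0, 0, 1) ∨ (x, y, z, w) = (3, 0, 0, -1))) := by
  refine ⟨?_, fun x y z w ↦ ⟨?_, ?_⟩⟩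
  · rintro ⟨x, y, z, w, hq, hl⟩
    have h := lBiii3_sq_sub_four_mul_qBiii3 x y z w
    rw [hq, hl] at h
    have hw : w = 0 := by
      have : -1 < w := by nlinarith [sq_nonneg z]
      have : w < 1 := by nlinarith [sq_nonneg z]
      omega
    subst hw
    unfold lBiii3 at hl
    omega
  · rintro ⟨hq, hl₀, hl₄⟩
    have h := lBiii3_sq_sub_four_mul_qBiii3 x y z w
    obtain ⟨l, hl⟩ : ∃ l, lBiii3 x y z w = l := ⟨_, rfl⟩
    obtain ⟨e, he⟩ : ∃ e, 2 * (x - y) + 3 * w = e := ⟨_, rfl⟩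
    rw [hl] at hl₀ hl₄
    rw [hq, hl, he] at h
    unfold lBiii3 at hl
    have hw₁ : -2 < w := by nlinarith [sq_nonneg z, sq_nonneg e]
    have hw₂ : w < 2 := by nlinarith [sq_nonneg z, sq_nonneg e]
    have hz₁ : -2 < z := by nlinarith [sq_nonneg w, sq_nonneg e]
    have hz₂ : z < 2 := by nlinarith [sq_nonneg w, sq_nonneg e]
    have he₁ : -5 < e := by nlinarith [sq_nonneg w, sq_nonneg z]
    have he₂ : e < 5 := by nlinarith [sq_nonneg w, sq_nonneg z]
    simp only [Prod.mk.injEq]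
    interval_cases w <;> interval_cases z <;> interval_cases l <;> first
      | omega
      | (interval_cases e <;> omega)
  · simp only [Prod.mk.injEq]
    rintro (⟨rfl, rfl, rfl, rfl⟩ | ⟨rfl, rfl, rfl, rfl⟩ | ⟨rfl, rfl, rfl, rfl⟩ |
      ⟨rfl, rfl, rfl, rfl⟩) <;> norm_num [qBiii3, lBiii3]
end

section
/- Define q(x, y, z) = 6x² − 2y² + 8z² + 4xy + 22xz + 16yz and ℓ(x, y, z) = 6x + 2y + 11z. There exist no integers x, y, z such that q(x, y, z) = 0 and ℓ(x, y, z) ∈ {1, 2, 3}. -/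
def qBiii4 (x y z : ℤ) : ℤ :=
  6 * x ^ 2 - 2 * y ^ 2 + 8 * z ^ 2 + 4 * x * y + 22 * x * z + 16 * y * z

def lBiii4 (x y z : ℤ) : ℤ := 6 * x + 2 * y + 11 * z

/-- Completing squares diagonalizes the form, with signature `(1, 2)`. -/
theorem four_mul_lBiii4_sq (x y z : ℤ) :
    4 * lBiii4 x y z ^ 2 = 24 * qBiii4 x y z + (8 * y - 13 * z) ^ 2 + 123 * z ^ 2 := by
  unfold lBiii4 qBiii4
  ring

/-- Claims (i)-(iii) in Section 3.9 (Case (B-iii-4)). -/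
theorem stmt_17 :
    ¬ ∃ x y z : ℤ, qBiii4 x y z = 0 ∧ lBiii4 x y z ∈ ({1, 2, 3} : Set ℤ) := by
  rintro ⟨x, y, z, hq, hl⟩
  have key := four_mul_lBiii4_sq x y z
  rw [hq] at key
  generalize lBiii4 x y z = l at hl key
  simp only [Set.mem_insert_iff, Set.mem_singleton_iff] at hl
  have hl9 : l ^ 2 ≤ 9 := by rcases hl with rfl | rfl | rfl <;> norm_num
  have hz : z = 0 := by
    have : z ^ 2 < 1 := by linarith [sq_nonneg (8 * y - 13 * z)]
    simpa using this
  subst hz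
  have hy : l ^ 2 = (4 * y) ^ 2 := by linarith
  rcases sq_eq_sq_iff_eq_or_eq_neg.mp hy with h | h <;> omega
end

section
/- Define q(x, y, z) = 6x² − 2y² + 8z² + 4xy + 22xz + 16yz and ℓ(x, y, z) = 6x + 2y + 11z. The only integers x, y, z satisfying q(x, y, z) = −2 and 0 < ℓ(x, y, z) ≤ 10 are (x, y, z) = (0, 1, 0), (3, −1, −1), and (4, −3, −1). -/
/-- Claim (iv) in Section 3.9 (Case (B-iii-4)): the only (−2)-classes of degree at most 10
are C₂ = Γ, C₅ = 3H − Γ − B and C₇ = 4H − 3Γ − B. -/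
theorem stmt_18 (x y z : ℤ) :
    (qBiii4 x y z = -2 ∧ 0 < lBiii4 x y z ∧ lBiii4 x y z ≤ 10) ↔
      ((x, y, z) = (0, 1, 0) ∨ (x, y, z) = (3, -1, -1) ∨ (x, y, z) = (4, -3, -1)) := by
  constructor
  · rintro ⟨hq, hpos, hle⟩
    have key : 16 * y ^ 2 - 52 * y * z + 73 * z ^ 2 = lBiii4 x y z ^ 2 + 12 := by
      unfold qBiii4 at hq
      unfold lBiii4
      linear_combination -6 * hq
    have hbound : 16 * y ^ 2 - 52 * y * z + 73 * z ^ 2 ≤ 112 := by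
      rw [key]
      nlinarith
    have hz : z ^ 2 < 2 ^ 2 := by nlinarith [sq_nonneg (8 * y - 13 * z)]
    have hy : y ^ 2 < 5 ^ 2 := by nlinarith [sq_nonneg (26 * y - 73 * z)]
    obtain ⟨hz₁, hz₂⟩ := abs_lt_of_sq_lt_sq' hz (by norm_num)
    obtain ⟨hy₁, hy₂⟩ := abs_lt_of_sq_lt_sq' hy (by norm_num)
    unfold lBiii4 at hpos hle
    unfold qBiii4 at hq
    have hx₁ : -5 < x := by omega
    have hx₂ : x < 6 := by omega
    simp only [Prod.mk.injEq]
    clear key hbound hz hy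
    interval_cases z <;> interval_cases y <;> interval_cases x <;> omega
  · simp only [Prod.mk.injEq]
    rintro (⟨rfl, rfl, rfl⟩ | ⟨rfl, rfl, rfl⟩ | ⟨rfl, rfl, rfl⟩) <;>
      norm_num [qBiii4, lBiii4]
end
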